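/- arXiv:2406.04936 — 5 statements merged into one kernel-verified Lean document; each statement's English description precedes it below -/
import Mathlib

section
/- In ℝ≥0∞, multiplication lax-linearly distributes over its de Morgan dual: for all a, b, c ∈ ℝ≥0∞, a·(b⁻¹·c⁻¹)⁻¹ ≤ ((a·b)⁻¹·c⁻¹)⁻¹, i.e. a ⊗ (b ⊗* c) ≤ (a ⊗ b) ⊗* c. -/
open ENNReal

/-- Lax linear distributivity: `a ⊗ (b ⊗* c) ≤ (a ⊗ b) ⊗* c` in `[0,∞]`,
where `x ⊗* y := (x⁻¹·y⁻¹)⁻¹`. -/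
theorem lax_linear_distributivity (a b c : ℝ≥0∞) :
    a * (b⁻¹ * c⁻¹)⁻¹ ≤ ((a * b)⁻¹ * c⁻¹)⁻¹ := by
  rcases eq_or_ne a 0 with rfl | ha
  · simp
  rcases eq_or_ne a ∞ with rfl | ha'
  · rcases eq_or_ne b 0 with rfl | hb
    · rcases eq_or_ne c ∞ with rfl | hc
      · simp
      · simp [ENNReal.top_mul, hc]
    · simp [ENNReal.top_mul, hb]
  · rw [ENNReal.mul_inv (.inl ha) (.inl ha'), mul_assoc,
      ENNReal.mul_inv (.inl (ENNReal.inv_ne_zero.2 ha')) (.inl (ENNReal.inv_ne_top.2 ha)),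
      inv_inv]
end

section
/- Fundamental property of harmonic p-sums: for any real p > 0, any (countable or finite) family (bᵢ)_{i∈ι} in ℝ≥0∞ and any a ∈ ℝ≥0∞, the harmonic p-sum of the family (bᵢ ⊸ a) equals (⊕^p b) ⊸ a, where ⊕^p b is the p-sum of the bᵢ; explicitly, (∑'_{i} ((bᵢ·a⁻¹)⁻¹)^(−p))^(−1/p) = ((∑'_{i} bᵢ^p)^(1/p)·a⁻¹)⁻¹. -/
open ENNReal

/-- Fundamental property of harmonic `p`-sums:
`⊕^{-p}_i (bᵢ ⊸ a) = (⊕^p_i bᵢ) ⊸ a`, where `x ⊸ y := (x·y⁻¹)⁻¹`,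
for a countable (or finite) family. -/
theorem harmonic_pSum_fundamental {ι : Type*} [Countable ι] (p : ℝ) (hp : 0 < p)
    (b : ι → ℝ≥0∞) (a : ℝ≥0∞) :
    (∑' i, ((b i * a⁻¹)⁻¹) ^ (-p)) ^ (-1 / p)
      = ((∑' i, b i ^ p) ^ (1 / p) * a⁻¹)⁻¹ := by
  have hp_inv : 0 ≤ 1 / p := by positivity
  have hterm (i : ι) : ((b i * a⁻¹)⁻¹) ^ (-p) = b i ^ p * a⁻¹ ^ p := by
    rw [ENNReal.rpow_neg, ENNReal.inv_rpow (b i * a⁻¹), inv_inv,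
      ENNReal.mul_rpow_of_nonneg _ _ hp.le]
  simp_rw [hterm]
  rw [ENNReal.tsum_mul_right, neg_div, ENNReal.rpow_neg,
    ENNReal.mul_rpow_of_nonneg _ _ hp_inv, ← ENNReal.rpow_mul, mul_one_div_cancel hp.ne',
    ENNReal.rpow_one]
end

section
/- The harmonic p-mean is below the p-mean: if μ is a probability measure on a measurable space X, a : X → ℝ≥0∞ is AE-measurable with respect to μ, and p > 0 is real, then (∫⁻ a(x)^(−p) dμ)^(−1/p) ≤ (∫⁻ a(x)^p dμ)^(1/p). -/
open ENNReal MeasureTheory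

/-- The harmonic mean is below the arithmetic mean, for a probability measure. -/
theorem inv_lintegral_inv_le_lintegral {X : Type*} [MeasurableSpace X]
    (μ : Measure X) [IsProbabilityMeasure μ] {f : X → ℝ≥0∞} (hf : AEMeasurable f μ) :
    (∫⁻ x, (f x)⁻¹ ∂μ)⁻¹ ≤ ∫⁻ x, f x ∂μ := by
  by_cases hI : ∫⁻ x, f x ∂μ = ∞
  · simp [hI]
  by_cases hJ : ∫⁻ x, (f x)⁻¹ ∂μ = ∞
  · simp [hJ]
  refine (ENNReal.inv_le_iff_le_mul (fun h => absurd h hI) (fun h => absurd h hJ)).2 ?_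
  have h_one : ∫⁻ x, f x ^ (1 / 2 : ℝ) * (f x)⁻¹ ^ (1 / 2 : ℝ) ∂μ = 1 := by
    rw [← measure_univ (μ := μ), ← lintegral_one]
    refine lintegral_congr_ae ?_
    filter_upwards [ae_lt_top' hf hI, ae_lt_top' hf.inv hJ] with x hx hx'
    rw [← ENNReal.mul_rpow_of_nonneg _ _ (by norm_num),
      ENNReal.mul_inv_cancel (ENNReal.inv_lt_top.1 hx').ne' hx.ne, ENNReal.one_rpow]
  have h_holder := ENNReal.lintegral_mul_norm_pow_le hf hf.inv
    (p := 1 / 2) (q := 1 / 2) (by norm_num) (by norm_num) (by norm_num)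
  simp only [Pi.inv_apply] at h_holder
  rw [h_one, ← ENNReal.mul_rpow_of_nonneg _ _ (by norm_num), mul_comm] at h_holder
  rwa [← ENNReal.one_rpow (1 / 2), ENNReal.rpow_le_rpow_iff (by norm_num)] at h_holder

/-- The harmonic `p`-mean is below the `p`-mean, for a probability measure. -/
theorem harmonic_pMean_le_pMean {X : Type*} [MeasurableSpace X]
    (μ : Measure X) [IsProbabilityMeasure μ] (a : X → ℝ≥0∞)
    (ha : AEMeasurable a μ) (p : ℝ) (hp : 0 < p) :
    (∫⁻ x, a x ^ (-p) ∂μ) ^ (-1 / p) ≤ (∫⁻ x, a x ^ p ∂μ) ^ (1 / p) := by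
  simp_rw [neg_div, ENNReal.rpow_neg]
  rw [← ENNReal.inv_rpow]
  exact ENNReal.rpow_le_rpow (inv_lintegral_inv_le_lintegral μ (ha.pow_const p)) (by positivity)
end

section
/- Argmax is the qualitative truncation of the ∞-softmax: for any function f : X → ℝ≥0∞ and any point x₀ ∈ X, the point x₀ is a maximizer of f (i.e. f(x) ≤ f(x₀) for all x ∈ X) if and only if 1 ≤ ⨅_{x∈X} (f(x)·(f(x₀))⁻¹)⁻¹. -/
open ENNReal

/-- Argmax is the qualitative truncation of the `∞`-softmax: `x₀` maximizes `f`
iff the unitary separator accepts `⨅ x, f x ⊸ f x₀`, where `a ⊸ b := (a·b⁻¹)⁻¹`. -/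
theorem argmax_eq_softmax_infty {X : Type*} (f : X → ℝ≥0∞) (x₀ : X) :
    (∀ x, f x ≤ f x₀) ↔ 1 ≤ ⨅ x, (f x * (f x₀)⁻¹)⁻¹ := by
  simp_rw [le_iInf_iff, ENNReal.one_le_inv, ← div_eq_mul_inv]
  refine forall_congr' fun x => ?_
  rw [ENNReal.div_le_iff_le_mul (Or.inr one_ne_top) (Or.inr one_ne_zero), one_mul]
end

section
/- Classification of separators on the multiplicative reals: let S ⊆ ℝ≥0∞ be a set such that (i) S is closed under arbitrary infima (for every A ⊆ S, sInf A ∈ S; in particular ∞ = sInf ∅ ∈ S), (ii) S is upward closed (a ∈ S and a ≤ b imply b ∈ S), and (iii) S is closed under multiplication (a, b ∈ S imply a·b ∈ S). Then either S = ℝ≥0∞ (the inconsistent separator) or there exists t ∈ ℝ≥0∞ with 1 ≤ t such that S = [t, ∞] (the closed upper interval Ici t). -/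
open ENNReal

/-- Classification of separators on the multiplicative reals: a subset of
`[0,∞]` closed under arbitrary infima, upward closed, and closed under
multiplication is either everything or a closed upper interval `[t,∞]` with
`t ≥ 1`. -/
theorem separator_classification (S : Set ℝ≥0∞)
    (hInf : ∀ A ⊆ S, sInf A ∈ S)
    (hUp : ∀ a ∈ S, ∀ b, a ≤ b → b ∈ S)
    (hMul : ∀ a ∈ S, ∀ b ∈ S, a * b ∈ S) :
    S = Set.univ ∨ ∃ t : ℝ≥0∞, 1 ≤ t ∧ S = Set.Ici t := by
  have ht : sInf S ∈ S := hInf S subset_rfl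
  have hS : S = Set.Ici (sInf S) :=
    Set.Subset.antisymm (fun _ hx => sInf_le hx) fun x hx => hUp _ ht x hx
  rcases le_or_gt 1 (sInf S) with h1 | h1
  · exact Or.inr ⟨sInf S, h1, hS⟩
  · left
    have h0 : sInf S = 0 := by
      by_contra h0
      have hlt : sInf S * sInf S < sInf S * 1 :=
        ENNReal.mul_lt_mul_right h0 h1.ne_top h1
      rw [mul_one] at hlt
      exact hlt.not_ge (sInf_le (hMul _ ht _ ht))
    rw [hS, h0]
    exact Set.Ici_bot
end
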